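/- arXiv:2407.07211 — 3 statements merged into one kernel-verified Lean document; each statement's English description precedes it below -/
import Mathlib

section
/- Let p ≥ 5 be a prime. Then the Sylow 3-subgroups of SL_2(F_p) are cyclic, and any two subgroups of order 3 of SL_2(F_p) are conjugate in SL_2(F_p). -/
namespace Matrix.SpecialLinearGroup

variable {F : Type*} [Field F]

/-- The companion matrix of `X ^ 2 + X + 1`, an element of order `3` of `SL₂(F)`. -/
def orderThree (F : Type*) [Field F] : SpecialLinearGroup (Fin 2) F :=
  ⟨!![0, -1; 1, -1], by simp [det_fin_two]⟩

/-- A nontrivial cube root of unity in `SL₂` has trace `-1`. -/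
theorem trace_eq_neg_one_of_pow_three_eq_one {g : SpecialLinearGroup (Fin 2) F}
    (hg : g ^ 3 = 1) (hg1 : g ≠ 1) : g 0 0 + g 1 1 = -1 := by
  have hd : g 0 0 * g 1 1 - g 0 1 * g 1 0 = 1 :=
    (det_fin_two g.1).symm.trans g.2
  have e : ∀ i j, (g.1 * g.1 * g.1) i j = (1 : Matrix (Fin 2) (Fin 2) F) i j := by
    intro i j
    have := congrArg (fun x : SpecialLinearGroup (Fin 2) F => x.1 i j) hg
    simpa [pow_succ] using this
  have e00 := e 0 0
  have e01 := e 0 1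
  have e10 := e 1 0
  have e11 := e 1 1
  simp only [Matrix.mul_apply, Fin.sum_univ_two, Matrix.one_apply] at e00 e01 e10 e11
  simp only [Fin.isValue, if_true, zero_ne_one, one_ne_zero, if_false] at e00 e01 e10 e11
  change g.1 0 0 + g.1 1 1 = -1
  change g.1 0 0 * g.1 1 1 - g.1 0 1 * g.1 1 0 = 1 at hd
  have hne : ¬ (g.1 0 0 = 1 ∧ g.1 0 1 = 0 ∧ g.1 1 0 = 0 ∧ g.1 1 1 = 1) := by
    rintro ⟨h1, h2, h3, h4⟩
    apply hg1
    ext i j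
    fin_cases i <;> fin_cases j <;> simp [h1, h2, h3, h4]
  generalize g.1 0 0 = a at *
  generalize g.1 0 1 = b at *
  generalize g.1 1 0 = c at *
  generalize g.1 1 1 = d at *
  have k00 : ((a + d) ^ 2 - 1) * a - (a + d) = 1 := by linear_combination e00 + (2 * a + d) * hd
  have k11 : ((a + d) ^ 2 - 1) * d - (a + d) = 1 := by linear_combination e11 + (a + 2 * d) * hd
  have k01 : ((a + d) ^ 2 - 1) * b = 0 := by linear_combination e01 + b * hd
  have k10 : ((a + d) ^ 2 - 1) * c = 0 := by linear_combination e10 + c * hd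
  by_cases ht : (a + d) ^ 2 - 1 = 0
  · linear_combination a * ht - k00
  · have hb := (mul_eq_zero.1 k01).resolve_left ht
    have hc := (mul_eq_zero.1 k10).resolve_left ht
    have had : a = d := by
      apply mul_left_cancel₀ ht
      linear_combination k00 - k11
    subst had hb hc
    have : a = 1 := by linear_combination e00 - a * hd
    exact absurd ⟨this, rfl, rfl, this⟩ hne

/-- Over a finite field of characteristic not `2` or `3`, the elements of `SL₂` of trace `-1`
form a single conjugacy class. -/
theorem isConj_orderThree [Finite F] (h2 : (2 : F) ≠ 0) (h3 : (3 : F) ≠ 0)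
    {g : SpecialLinearGroup (Fin 2) F} (hg : g 0 0 + g 1 1 = -1) :
    IsConj (orderThree F) g := by
  have hd : g 0 0 * g 1 1 - g 0 1 * g 1 0 = 1 :=
    (det_fin_two g.1).symm.trans g.2
  obtain ⟨x, y, hxy⟩ : ∃ x y : F,
      g 1 0 * x ^ 2 + (g 1 1 - g 0 0) * x * y - g 0 1 * y ^ 2 = 1 := by
    generalize g 0 0 = a at *
    generalize g 0 1 = b at *
    generalize g 1 0 = c at *
    generalize g 1 1 = d at *
    by_cases hc : c = 0
    · have hda : d - a ≠ 0 := by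
        intro h
        apply h3
        subst hc
        linear_combination (a + d - 1) * hg - 4 * hd - (d - a) * h
      refine ⟨(1 + b) / (d - a), 1, ?_⟩
      subst hc
      field_simp
      ring
    · have := Fintype.ofFinite F
      have hodd : Fintype.card F % 2 = 1 := by
        apply FiniteField.odd_card_of_char_ne_two
        intro h
        have := ringChar.spec F 2
        rw [h] at this
        exact h2 (by simpa using this)
      obtain ⟨u, y, huy⟩ := FiniteField.exists_root_sum_quadratic
        (f := (Polynomial.X ^ 2 : Polynomial F))
        (g := (Polynomial.C 3 * Polynomial.X ^ 2 + Polynomial.C 0 * Polynomial.X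
          + Polynomial.C (-4 * c) : Polynomial F))
        (Polynomial.degree_X_pow 2) (Polynomial.degree_quadratic h3) hodd
      simp at huy
      refine ⟨(u - (d - a) * y) / (2 * c), y, ?_⟩
      field_simp
      linear_combination huy - y ^ 2 * ((a + d - 1) * hg - 4 * hd)
  let M : SpecialLinearGroup (Fin 2) F :=
    ⟨!![x, g 0 0 * x + g 0 1 * y; y, g 1 0 * x + g 1 1 * y], by
      rw [det_fin_two_of]; linear_combination hxy⟩
  rw [isConj_iff]
  refine ⟨M, ?_⟩
  rw [mul_inv_eq_iff_eq_mul]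
  ext i j
  change (M.1 * (orderThree F).1) i j = (g.1 * M.1) i j
  fin_cases i <;> fin_cases j <;>
    simp [M, orderThree, Matrix.mul_apply, Fin.sum_univ_two]
  · linear_combination (-g 0 0 * x - g 0 1 * y) * hg + x * hd
  · linear_combination (-g 1 0 * x - g 1 1 * y) * hg + y * hd

/-- The centralizer of `orderThree F` embeds in the multiplicative group of an algebraic closure
by its action on an eigenvector. -/
theorem isCyclic_centralizer_orderThree [Finite F] (h3 : (3 : F) ≠ 0) :
    IsCyclic (Subgroup.centralizer {orderThree F}) := by
  have hform : ∀ m ∈ Subgroup.centralizer {orderThree F},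
      m.1 0 1 = - m.1 1 0 ∧ m.1 1 1 = m.1 0 0 - m.1 1 0 := by
    intro m hm
    rw [Subgroup.mem_centralizer_singleton_iff] at hm
    have e : ∀ i j, (m.1 * (orderThree F).1) i j = ((orderThree F).1 * m.1) i j := by
      intro i j
      have := congrArg (fun x : SpecialLinearGroup (Fin 2) F => x.1 i j) hm
      simpa using this
    have e00 := e 0 0
    have e10 := e 1 0
    simp [orderThree, Matrix.mul_apply, Fin.sum_univ_two] at e00 e10
    exact ⟨e00, by linear_combination e10⟩
  obtain ⟨ω, hω⟩ := IsAlgClosed.exists_root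
    (Polynomial.C 1 * Polynomial.X ^ 2 + Polynomial.C 1 * Polynomial.X + Polynomial.C 1 :
      Polynomial (AlgebraicClosure F))
    (by rw [Polynomial.degree_quadratic one_ne_zero]; decide)
  simp at hω
  let i := algebraMap F (AlgebraicClosure F)
  have h3' : (3 : AlgebraicClosure F) ≠ 0 := by
    intro h
    apply h3
    apply i.injective
    rw [map_ofNat, map_zero, h]
  let f : Subgroup.centralizer {orderThree F} →* AlgebraicClosure F :=
    { toFun := fun m => i (m.1.1 0 0) + i (m.1.1 1 0) * ω
      map_one' := by simp
      map_mul' := by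
        rintro ⟨m, hm⟩ ⟨n, hn⟩
        obtain ⟨hm1, hm2⟩ := hform m hm
        obtain ⟨hn1, hn2⟩ := hform n hn
        simp only [coe_mul, MulMemClass.mk_mul_mk, Matrix.mul_apply,
          Fin.sum_univ_two, hm1, hm2, map_add, map_mul, map_neg, map_sub]
        linear_combination (-i (m.1 1 0) * i (n.1 1 0)) * hω }
  refine isCyclic_of_injective_ringHom f ((injective_iff_map_eq_one f).2 ?_)
  rintro ⟨m, hm⟩ h
  obtain ⟨hm1, hm2⟩ := hform m hm
  have hd : m.1 0 0 * m.1 1 1 - m.1 0 1 * m.1 1 0 = 1 :=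
    (det_fin_two m.1).symm.trans m.2
  rw [hm1, hm2] at hd
  have hd' := congrArg i hd
  change i (m.1 0 0) + i (m.1 1 0) * ω = 1 at h
  simp only [map_mul, map_neg, map_sub, map_one] at hd'
  have hy : i (m.1 1 0) * (2 * ω + 1) = 0 := by
    linear_combination (i (m.1 0 0) + 1 - i (m.1 1 0) * (1 + ω)) * h - hd'
      + (i (m.1 1 0)) ^ 2 * hω
  have hω' : 2 * ω + 1 ≠ 0 := by
    intro h
    apply h3'
    linear_combination 4 * hω - (2 * ω + 1) * h
  have hy0 := (mul_eq_zero.1 hy).resolve_right hω'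
  rw [hy0, zero_mul, add_zero] at h
  have hx : m.1 0 0 = 1 := i.injective (h.trans i.map_one.symm)
  have hy1 : m.1 1 0 = 0 := i.injective (hy0.trans i.map_zero.symm)
  ext k l
  fin_cases k <;> fin_cases l <;> simp [hx, hy1, hm1, hm2]

end Matrix.SpecialLinearGroup

/-- For a prime `p ≥ 5`, the Sylow `3`-subgroups of `SL₂(F_p)` are cyclic,
and any two subgroups of order `3` of `SL₂(F_p)` are conjugate in `SL₂(F_p)`. -/
theorem stmt2 (p : ℕ) [Fact p.Prime] (hp : 5 ≤ p) :
    (∀ P : Sylow 3 (Matrix.SpecialLinearGroup (Fin 2) (ZMod p)),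
      IsCyclic ↥(P : Subgroup (Matrix.SpecialLinearGroup (Fin 2) (ZMod p)))) ∧
    (∀ H K : Subgroup (Matrix.SpecialLinearGroup (Fin 2) (ZMod p)),
      Nat.card H = 3 → Nat.card K = 3 →
      ∃ g : Matrix.SpecialLinearGroup (Fin 2) (ZMod p),
        Subgroup.map (MulAut.conj g).toMonoidHom H = K) := by
  have hne : ∀ n : ℕ, 0 < n → n < 5 → (n : ZMod p) ≠ 0 := fun n hn hn5 h =>
    absurd (Nat.le_of_dvd hn ((ZMod.natCast_eq_zero_iff n p).1 h)) (by omega)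
  have h2 : (2 : ZMod p) ≠ 0 := by exact_mod_cast hne 2 (by norm_num) (by norm_num)
  have h3 : (3 : ZMod p) ≠ 0 := by exact_mod_cast hne 3 (by norm_num) (by norm_num)
  have hconj : ∀ g : Matrix.SpecialLinearGroup (Fin 2) (ZMod p), orderOf g = 3 →
      IsConj (Matrix.SpecialLinearGroup.orderThree (ZMod p)) g := by
    intro g hg
    refine Matrix.SpecialLinearGroup.isConj_orderThree h2 h3
      (Matrix.SpecialLinearGroup.trace_eq_neg_one_of_pow_three_eq_one ?_ ?_)
    · rw [← hg, pow_orderOf_eq_one]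
    · rintro rfl
      simp at hg
  constructor
  · intro P
    rcases subsingleton_or_nontrivial P with hP | hP
    · infer_instance
    have hZ : Nontrivial (Subgroup.center P) := P.isPGroup'.center_nontrivial
    obtain ⟨k, hk, hcard⟩ :=
      (P.isPGroup'.to_subgroup (Subgroup.center P)).nontrivial_iff_card.1 hZ
    obtain ⟨z, hz⟩ := exists_prime_orderOf_dvd_card' (G := Subgroup.center P) 3
      (hcard ▸ dvd_pow_self 3 hk.ne')
    have hz' : orderOf (z.1.1) = 3 :=
      (Subgroup.orderOf_coe z.1).trans ((Subgroup.orderOf_coe z).trans hz)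
    obtain ⟨m, hm⟩ := isConj_iff.1 (hconj _ hz')
    have := Matrix.SpecialLinearGroup.isCyclic_centralizer_orderThree h3
    refine isCyclic_of_injective
      (((MulAut.conj m⁻¹).toMonoidHom.comp (P : Subgroup _).subtype).codRestrict
        (Subgroup.centralizer {Matrix.SpecialLinearGroup.orderThree (ZMod p)}) ?_) ?_
    · intro x
      have hx : x.1 * z.1.1 = z.1.1 * x.1 :=
        congrArg Subtype.val (Subgroup.mem_center_iff.1 z.2 x)
      rw [← hm] at hx
      rw [Subgroup.mem_centralizer_singleton_iff]
      change m⁻¹ * x.1 * m⁻¹⁻¹ * _ = _ * (m⁻¹ * x.1 * m⁻¹⁻¹)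
      have := congrArg (fun t => m⁻¹ * t * m) hx
      simpa [mul_assoc] using this
    · intro x y hxy
      have := congrArg Subtype.val hxy
      exact Subtype.ext ((MulAut.conj m⁻¹).injective this)
  · have hgen : ∀ H : Subgroup (Matrix.SpecialLinearGroup (Fin 2) (ZMod p)), Nat.card H = 3 →
        ∃ m, Subgroup.map (MulAut.conj m).toMonoidHom
          (Subgroup.zpowers (Matrix.SpecialLinearGroup.orderThree (ZMod p))) = H := by
      intro H hH
      have := isCyclic_of_prime_card (p := 3) hH
      obtain ⟨h, hh⟩ := IsCyclic.exists_ofOrder_eq_natCard (α := H)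
      rw [hH, ← Subgroup.orderOf_coe] at hh
      obtain ⟨m, hm⟩ := isConj_iff.1 (hconj _ hh)
      refine ⟨m, ?_⟩
      rw [MonoidHom.map_zpowers]
      change Subgroup.zpowers (m * Matrix.SpecialLinearGroup.orderThree (ZMod p) * m⁻¹) = H
      rw [hm]
      apply Subgroup.eq_of_le_of_card_ge
      · simp
      · rw [hH, Nat.card_zpowers, hh]
    intro H K hH hK
    obtain ⟨m, rfl⟩ := hgen H hH
    obtain ⟨n, rfl⟩ := hgen K hK
    refine ⟨n * m⁻¹, ?_⟩
    rw [Subgroup.map_map]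
    congr 1
    ext x : 1
    simp [mul_assoc]
end

section
/- Let p be a prime, let V be a 3-dimensional vector space over F_p, and let G be a subgroup of GL(V) having no nontrivial normal p-subgroup. Then the order of a Sylow p-subgroup of G is not p²; and if the order of a Sylow p-subgroup of G is p³, then G contains SL(V). -/
open Module

/-- `G` contains the map `v ↦ v + f v • a`. -/
def HasTransvection {K V : Type*} [Field K] [AddCommGroup V] [Module K V]
    (G : Subgroup (LinearMap.GeneralLinearGroup K V)) (a : V) (f : Dual K V) : Prop :=
  ∃ g ∈ G, ∀ v, (g : V →ₗ[K] V) v = v + f v • a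

section Basics

variable {K V : Type*} [Field K] [AddCommGroup V] [Module K V]
  {G : Subgroup (LinearMap.GeneralLinearGroup K V)}

lemma units_inv_apply_self (g : LinearMap.GeneralLinearGroup K V) (v : V) :
    ((g⁻¹ : LinearMap.GeneralLinearGroup K V) : V →ₗ[K] V) ((g : V →ₗ[K] V) v) = v := by
  rw [← Module.End.mul_apply, ← Units.val_mul, inv_mul_cancel, Units.val_one, Module.End.one_apply]

lemma units_apply_inv_self (g : LinearMap.GeneralLinearGroup K V) (v : V) :
    (g : V →ₗ[K] V) (((g⁻¹ : LinearMap.GeneralLinearGroup K V) : V →ₗ[K] V) v) = v := by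
  rw [← Module.End.mul_apply, ← Units.val_mul, mul_inv_cancel, Units.val_one, Module.End.one_apply]

namespace HasTransvection

lemma mono {H : Subgroup (LinearMap.GeneralLinearGroup K V)} (hGH : G ≤ H) {a : V} {f : Dual K V}
    (h : HasTransvection G a f) : HasTransvection H a f := by
  obtain ⟨g, hg, hgv⟩ := h
  exact ⟨g, hGH hg, hgv⟩

lemma conj {a : V} {f : Dual K V} (h : HasTransvection G a f)
    {g : LinearMap.GeneralLinearGroup K V} (hg : g ∈ G) :
    HasTransvection G ((g : V →ₗ[K] V) a)
      (f ∘ₗ ((g⁻¹ : LinearMap.GeneralLinearGroup K V) : V →ₗ[K] V)) := by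
  obtain ⟨t, ht, htv⟩ := h
  refine ⟨g * t * g⁻¹, G.mul_mem (G.mul_mem hg ht) (G.inv_mem hg), fun v => ?_⟩
  rw [Units.val_mul, Units.val_mul, Module.End.mul_apply, Module.End.mul_apply, htv, map_add,
    map_smul, units_apply_inv_self]
  rfl

lemma zero_left (f : Dual K V) : HasTransvection G 0 f :=
  ⟨1, G.one_mem, fun v => by simp⟩

lemma add_right {a : V} {f g : Dual K V} (hf : HasTransvection G a f)
    (hg : HasTransvection G a g) (hga : f a = 0) : HasTransvection G a (f + g) := by
  obtain ⟨t, ht, htv⟩ := hf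
  obtain ⟨s, hs, hsv⟩ := hg
  refine ⟨t * s, G.mul_mem ht hs, fun v => ?_⟩
  simp [htv, hsv, hga, add_smul]
  abel

lemma add_left {a b : V} {f : Dual K V} (ha : HasTransvection G a f)
    (hb : HasTransvection G b f) (hfb : f b = 0) : HasTransvection G (a + b) f := by
  obtain ⟨t, ht, htv⟩ := ha
  obtain ⟨s, hs, hsv⟩ := hb
  refine ⟨t * s, G.mul_mem ht hs, fun v => ?_⟩
  simp [htv, hsv, hfb]
  abel

lemma smul_right_of_smul_left {a : V} {f : Dual K V} {c : K} (h : HasTransvection G (c • a) f) :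
    HasTransvection G a (c • f) := by
  obtain ⟨t, ht, htv⟩ := h
  refine ⟨t, ht, fun v => ?_⟩
  simp [htv, smul_smul, mul_comm]

end HasTransvection

end Basics

section SpecialLinear

variable {K V : Type*} [Field K] [AddCommGroup V] [Module K V]
  {G : Subgroup (LinearMap.GeneralLinearGroup K V)}

open Matrix Matrix.SpecialLinearGroup in
lemma diag2n_eq_prod_transvection {ι : Type*} [Fintype ι] [DecidableEq ι] {i j : ι} (hij : i ≠ j)
    {c : K} (hc : c ≠ 0) :
    diag2n hij c hc = transvection hij c * transvection hij.symm (- c⁻¹) * transvection hij c *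
      transvection hij (-1) * transvection hij.symm 1 * transvection hij (-1) := by
  have hji := hij.symm
  apply Subtype.ext
  simp only [diag2n_coe, coe_mul]
  apply Matrix.toLin'.injective
  refine LinearMap.ext fun v => funext fun k => ?_
  have key : ∀ (i j : ι) (hij : i ≠ j) (c : K) (v : ι → K),
      (transvection hij c).1 *ᵥ v = fun k => v k + if k = i then c * v j else 0 := by
    intro i j hij c v
    ext k
    simp [transvection_coe, Matrix.add_mulVec, Matrix.single_mulVec, Function.update_apply]
  simp only [Matrix.toLin'_apply, ← Matrix.mulVec_mulVec, key, mulVec_diagonal]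
  by_cases hki : k = i
  · subst hki
    simp [hij, hji]
    field_simp
    ring
  · by_cases hkj : k = j
    · subst hkj
      simp [hij, hji]
      field_simp
      ring
    · simp [hki, hkj]

open Matrix Matrix.SpecialLinearGroup in
/-- A subgroup of `GL(V)` containing all transvections contains `SL(V)`. -/
lemma ker_det_le_of_forall_hasTransvection [Module.Finite K V] (hV : 2 ≤ finrank K V)
    (h : ∀ (a : V) (f : Dual K V), f a = 0 → HasTransvection G a f) :
    (Units.map (LinearMap.det : (V →ₗ[K] V) →* K)).ker ≤ G := by
  intro x hx
  let b := Module.finBasis K V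
  have : Nontrivial (Fin (finrank K V)) := Fin.nontrivial_iff_two_le.mpr hV
  have hdet : (LinearMap.toMatrix b b (x : V →ₗ[K] V)).det = 1 := by
    rw [LinearMap.det_toMatrix]
    exact congrArg Units.val hx
  let P : SpecialLinearGroup (Fin (finrank K V)) K → Prop := fun A =>
    ∃ g ∈ G, (g : V →ₗ[K] V) = Matrix.toLin b b A
  have hmul : ∀ A B, P A → P B → P (A * B) := by
    rintro A B ⟨g, hg, hgA⟩ ⟨k, hk, hkB⟩
    refine ⟨g * k, G.mul_mem hg hk, ?_⟩
    rw [Units.val_mul, hgA, hkB, coe_mul, Matrix.toLin_mul b b b]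
    rfl
  have htr : ∀ (i j) (hij : i ≠ j) (c : K), P (transvection hij c) := by
    intro i j hij c
    obtain ⟨g, hg, hgv⟩ := h (b i) (c • b.coord j) (by simp [hij])
    refine ⟨g, hg, b.ext fun k => ?_⟩
    rw [hgv, Matrix.toLin_self, transvection_coe]
    by_cases hk : k = j
    · subst hk
      simp [Matrix.add_apply, add_smul, Finset.sum_add_distrib, Matrix.single_apply,
        Matrix.one_apply]
    · simp [Matrix.add_apply, Matrix.one_apply, Ne.symm hk]
  obtain ⟨g, hg, hgx⟩ : P ⟨_, hdet⟩ := diagonal_transvection_induction' P _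
    (fun i j hij c hc => by
      rw [diag2n_eq_prod_transvection hij hc]
      exact hmul _ _ (hmul _ _ (hmul _ _ (hmul _ _ (hmul _ _ (htr ..) (htr ..)) (htr ..))
        (htr ..)) (htr ..)) (htr ..)) htr hmul
  have : g = x := by
    apply Units.ext
    rw [hgx]
    exact Matrix.toLin_toMatrix b b _
  exact this ▸ hg

end SpecialLinear

section PrimeField

variable {p : ℕ} [Fact p.Prime] {V : Type*} [AddCommGroup V] [Module (ZMod p) V]
  {G : Subgroup (LinearMap.GeneralLinearGroup (ZMod p) V)}

namespace HasTransvection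

lemma smul_left {a : V} {f : Dual (ZMod p) V} (h : HasTransvection G a f) (ha : f a = 0)
    (c : ZMod p) : HasTransvection G (c • a) f := by
  have key : ∀ n : ℕ, HasTransvection G ((n : ZMod p) • a) f := by
    intro n
    induction n with
    | zero => simpa using zero_left f
    | succ n ih =>
      rw [Nat.cast_succ, add_smul, one_smul]
      exact ih.add_left h ha
  simpa using key c.val

lemma smul_right {a : V} {f : Dual (ZMod p) V} (h : HasTransvection G a f) (ha : f a = 0)
    (c : ZMod p) : HasTransvection G a (c • f) :=
  smul_right_of_smul_left (h.smul_left ha c)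

/-- If `f b ≠ 0` and `g a = 0`, the transvections along `(a, f)` and `(b, g)` do not commute and
produce one along `(a, g)`. -/
lemma left_right {a b : V} {f g : Dual (ZMod p) V} (hf : HasTransvection G a f)
    (hg : HasTransvection G b g) (hgb : g b = 0) (hfb : f b ≠ 0) (hga : g a = 0) :
    HasTransvection G a g := by
  obtain ⟨t, ht, htv⟩ := id hf
  have h₁ := hg.conj ht
  have h₂ : g ∘ₗ ((t⁻¹ : LinearMap.GeneralLinearGroup (ZMod p) V) : V →ₗ[ZMod p] V) = g := by
    refine LinearMap.ext fun v => ?_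
    have := htv (((t⁻¹ : LinearMap.GeneralLinearGroup (ZMod p) V) : V →ₗ[ZMod p] V) v)
    rw [units_apply_inv_self] at this
    conv_rhs => rw [this]
    simp [hga]
  rw [h₂, htv] at h₁
  have h₃ := h₁.add_left (hg.smul_left hgb (-1)) (by simp [hgb])
  have h₄ : b + f b • a + (-1 : ZMod p) • b = f b • a := by
    rw [neg_one_smul]; abel
  rw [h₄] at h₃
  have h₅ := h₃.smul_left (by simp [hga]) (f b)⁻¹
  rwa [smul_smul, inv_mul_cancel₀ hfb, one_smul] at h₅

end HasTransvection

/-- If an irreducible group contains all transvections with one given centre, it contains all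
transvections. -/
lemma forall_hasTransvection_of_centre
    (hirr : ∀ W : Submodule (ZMod p) V, (∀ g ∈ G, ∀ w ∈ W, (g : V →ₗ[ZMod p] V) w ∈ W) →
      W = ⊥ ∨ W = ⊤) {a : V} (ha : a ≠ 0)
    (h : ∀ f : Dual (ZMod p) V, f a = 0 → HasTransvection G a f) (b : V) (f : Dual (ZMod p) V)
    (hfb : f b = 0) : HasTransvection G b f := by
  have hconj : ∀ g ∈ G, ∀ w, (∀ f : Dual (ZMod p) V, f w = 0 → HasTransvection G w f) →
      ∀ f : Dual (ZMod p) V, f ((g : V →ₗ[ZMod p] V) w) = 0 →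
        HasTransvection G ((g : V →ₗ[ZMod p] V) w) f := by
    intro g hg w hw f hf
    have := (hw (f ∘ₗ (g : V →ₗ[ZMod p] V)) hf).conj hg
    rwa [LinearMap.comp_assoc, ← Module.End.mul_eq_comp, ← Units.val_mul, mul_inv_cancel,
      Units.val_one, Module.End.one_eq_id, LinearMap.comp_id] at this
  have hsmul : ∀ (c : ZMod p) (w : V),
      (∀ f : Dual (ZMod p) V, f w = 0 → HasTransvection G w f) →
      ∀ f : Dual (ZMod p) V, f (c • w) = 0 → HasTransvection G (c • w) f := by
    intro c w hw f hf
    by_cases hc : c = 0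
    · rw [hc, zero_smul]
      exact .zero_left f
    · have hfw : f w = 0 := by simpa [hc] using hf
      exact (hw f hfw).smul_left hfw c
  let A : Submodule (ZMod p) V :=
    { carrier := {v | ∀ f : Dual (ZMod p) V, f v = 0 → HasTransvection G v f}
      zero_mem' := fun f _ => .zero_left f
      smul_mem' := fun c w hw => hsmul c w hw
      add_mem' := by
        intro v w hv hw
        by_cases hvw : w ∈ Submodule.span (ZMod p) {v}
        · obtain ⟨c, rfl⟩ := Submodule.mem_span_singleton.mp hvw
          have := hsmul (1 + c) v hv
          rwa [add_smul, one_smul] at this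
        · obtain ⟨f, hfw, hfv⟩ := Submodule.exists_le_ker_of_notMem hvw
          have hfv : f v = 0 := hfv (Submodule.mem_span_singleton_self v)
          obtain ⟨g, hg, hgv⟩ := (hv f hfv).smul_right hfv (f w)⁻¹
          have := hconj g hg w hw
          rw [hgv] at this
          simpa [hfw, add_comm] using this }
  have hA : A = ⊥ ∨ A = ⊤ := hirr A fun g hg w hw => hconj g hg w hw
  rcases hA with hA | hA
  · exact absurd ((Submodule.mem_bot _).mp (hA ▸ (show a ∈ A from h))) ha
  · exact (show b ∈ A from hA ▸ Submodule.mem_top) f hfb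

end PrimeField

section Coordinates

variable {K V : Type*} [Field K] [AddCommGroup V] [Module K V]

lemma exists_coords [Module.Finite K V] (hdim : finrank K V = 3) {a m b : V} {f : Dual K V}
    (ha : a ≠ 0) (hm : m ∉ Submodule.span K {a}) (hfa : f a = 0) (hfm : f m = 0) (hfb : f b ≠ 0)
    (v : V) : ∃ x y z : K, v = x • a + y • m + z • b := by
  have hli : LinearIndependent K ![a, m, b] := by
    rw [Fintype.linearIndependent_iff]
    intro c hc
    simp only [Fin.sum_univ_three, Matrix.cons_val_zero, Matrix.cons_val_one,
      Matrix.cons_val_two] at hc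
    have h2 : c 2 = 0 := by
      have := congrArg f hc
      simpa [hfa, hfm, hfb] using this
    have h1 : c 1 = 0 := by
      by_contra h1
      apply hm
      rw [Submodule.mem_span_singleton]
      refine ⟨-(c 1)⁻¹ * c 0, ?_⟩
      rw [h2, zero_smul, add_zero] at hc
      rw [mul_smul, eq_neg_of_add_eq_zero_left hc, smul_neg, smul_smul, neg_mul,
        inv_mul_cancel₀ h1, neg_one_smul, neg_neg]
    have h0 : c 0 = 0 := by
      simpa [h1, h2, ha] using hc
    intro i
    fin_cases i <;> assumption
  have hspan := hli.span_eq_top_of_card_eq_finrank' (by simp [hdim])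
  have hv : v ∈ Submodule.span K (Set.range ![a, m, b]) := hspan ▸ Submodule.mem_top
  rw [Matrix.range_cons, Matrix.range_cons, Matrix.range_cons, Matrix.range_empty,
    Set.union_empty, Set.singleton_union, Set.singleton_union, Submodule.mem_span_triple] at hv
  obtain ⟨x, y, z, h⟩ := hv
  exact ⟨x, y, z, h.symm⟩

lemma exists_mem_ker_notMem_span_singleton [Module.Finite K V] (hdim : finrank K V = 3) (a : V)
    (f : Dual K V) : ∃ m, f m = 0 ∧ m ∉ Submodule.span K {a} := by
  by_contra! h
  have h₁ : f.ker ≤ Submodule.span K {a} := fun m hm => h m hm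
  have h₂ := Submodule.finrank_mono h₁
  have h₃ : finrank K (Submodule.span K {a}) ≤ 1 := by
    simpa using finrank_span_le_card (R := K) ({a} : Set V)
  have h₄ := f.finrank_range_add_finrank_ker
  have h₅ := f.range.finrank_le
  rw [finrank_self] at h₅
  omega

end Coordinates

section Dim3

variable {p : ℕ} [Fact p.Prime] {V : Type*} [AddCommGroup V] [Module (ZMod p) V]
  [Module.Finite (ZMod p) V] {G : Subgroup (LinearMap.GeneralLinearGroup (ZMod p) V)}

lemma forall_hasTransvection_of_two_axes (hdim : finrank (ZMod p) V = 3) {a b : V}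
    {f g : Dual (ZMod p) V} (hf : HasTransvection G a f) (hg : HasTransvection G a g)
    (hfa : f a = 0) (hga : g a = 0) (hfb : f b ≠ 0) (hgb : g b = 0) (hg0 : g ≠ 0)
    (h : Dual (ZMod p) V) (hha : h a = 0) : HasTransvection G a h := by
  by_cases ha : a = 0
  · rw [ha]
    exact .zero_left h
  obtain ⟨u, hu⟩ : ∃ u, g u ≠ 0 := by
    by_contra! hu
    exact hg0 (LinearMap.ext hu)
  have hb : b ∉ Submodule.span (ZMod p) {a} := by
    rw [Submodule.mem_span_singleton]
    rintro ⟨c, rfl⟩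
    simp [hfa] at hfb
  set c := h b / f b with hc
  set d := (h u - c * f u) / g u with hd
  have : h = c • f + d • g := by
    refine LinearMap.ext fun v => ?_
    obtain ⟨x, y, z, rfl⟩ := exists_coords hdim ha hb hga hgb hu v
    simp only [map_add, map_smul, smul_eq_mul, LinearMap.add_apply, LinearMap.smul_apply,
      hha, hfa, hga, hgb, hd, hc]
    field_simp
    ring
  rw [this]
  exact (hf.smul_right hfa c).add_right (hg.smul_right hga d) (by simp [hfa])

lemma forall_hasTransvection_of_asymmetric (hdim : finrank (ZMod p) V = 3) {a b : V}
    {f g : Dual (ZMod p) V} (hf : HasTransvection G a f) (hg : HasTransvection G b g)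
    (hfa : f a = 0) (hgb : g b = 0) (hfb : f b ≠ 0) (hga : g a = 0) (hg0 : g ≠ 0)
    (h : Dual (ZMod p) V) (hha : h a = 0) : HasTransvection G a h :=
  forall_hasTransvection_of_two_axes hdim hf (hf.left_right hg hgb hfb hga) hfa hga hfb hgb hg0 h
    hha

/-- An irreducible group containing a transvection and a further unipotent element stabilizing
the corresponding flag contains all transvections. -/
lemma forall_hasTransvection_of_unipotent (hdim : finrank (ZMod p) V = 3)
    (hirr : ∀ W : Submodule (ZMod p) V, (∀ g ∈ G, ∀ w ∈ W, (g : V →ₗ[ZMod p] V) w ∈ W) →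
      W = ⊥ ∨ W = ⊤) {a : V} {f : Dual (ZMod p) V} (ha : a ≠ 0) (hf : f ≠ 0) (hfa : f a = 0)
    (haf : HasTransvection G a f) {x : LinearMap.GeneralLinearGroup (ZMod p) V} (hxG : x ∈ G)
    (hxa : (x : V →ₗ[ZMod p] V) a = a) (hxf : ∀ v, f ((x : V →ₗ[ZMod p] V) v) = f v)
    (hxker : ∀ v, f v = 0 → ∃ c : ZMod p, (x : V →ₗ[ZMod p] V) v = v + c • a)
    (hx : ∀ c : ZMod p, ¬ ∀ v, (x : V →ₗ[ZMod p] V) v = v + (c * f v) • a) (v : V)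
    (h : Dual (ZMod p) V) (hhv : h v = 0) : HasTransvection G v h := by
  suffices ∃ v ≠ 0, ∀ f : Dual (ZMod p) V, f v = 0 → HasTransvection G v f by
    obtain ⟨w, hw0, hw⟩ := this
    exact forall_hasTransvection_of_centre hirr hw0 hw v h hhv
  clear hhv h v
  -- a conjugate transvection whose centre is not on the axis of the first
  obtain ⟨k, hk, hkb⟩ : ∃ k ∈ G, f ((k : V →ₗ[ZMod p] V) a) ≠ 0 := by
    by_contra! hk
    let W : Submodule (ZMod p) V := ⨅ k : G, (f ∘ₗ ((k : LinearMap.GeneralLinearGroup (ZMod p) V) :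
      V →ₗ[ZMod p] V)).ker
    have hW : ∀ v, v ∈ W ↔ ∀ k ∈ G, f ((k : V →ₗ[ZMod p] V) v) = 0 := by
      intro v
      simp [W, Submodule.mem_iInf]
    rcases hirr W fun g hg w hw => (hW _).mpr fun k hk => (hW w).mp hw _ (G.mul_mem hk hg) with h | h
    · have : a ∈ W := (hW a).mpr hk
      rw [h, Submodule.mem_bot] at this
      exact ha this
    · refine hf (LinearMap.ext fun v => ?_)
      exact (hW v).mp (h ▸ Submodule.mem_top) 1 G.one_mem
  obtain ⟨b, g, hbg, hgb, hfb, hg0⟩ : ∃ (b : V) (g : Dual (ZMod p) V), HasTransvection G b g ∧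
      g b = 0 ∧ f b ≠ 0 ∧ g ≠ 0 := by
    refine ⟨_, _, haf.conj hk, ?_, hkb, fun h => hf (LinearMap.ext fun v => ?_)⟩
    · simp [units_inv_apply_self, hfa]
    · have := congrArg (fun l : Dual (ZMod p) V => l ((k : V →ₗ[ZMod p] V) v)) h
      simpa [units_inv_apply_self] using this
  by_cases hga : g a = 0
  · exact ⟨a, ha, forall_hasTransvection_of_asymmetric hdim haf hbg hfa hgb hfb hga hg0⟩
  obtain ⟨m, hfm, hgm, hma⟩ : ∃ m, f m = 0 ∧ g m = 0 ∧ m ∉ Submodule.span (ZMod p) {a} := by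
    obtain ⟨m, hm, hma⟩ := exists_mem_ker_notMem_span_singleton hdim a f
    refine ⟨m - (g m / g a) • a, by simp [hm, hfa], by simp [hga], fun h => hma ?_⟩
    simpa using add_mem h
      (Submodule.smul_mem _ (g m / g a) (Submodule.mem_span_singleton_self a))
  have hm0 : m ≠ 0 := fun h => hma (h ▸ zero_mem _)
  -- normalize `x` modulo the transvections along `(a, f)`
  obtain ⟨y, hyG, hya, α, hym, β, hyb, hαβ⟩ : ∃ y ∈ G, (y : V →ₗ[ZMod p] V) a = a ∧
      ∃ α : ZMod p, (y : V →ₗ[ZMod p] V) m = m + α • a ∧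
      ∃ β : ZMod p, (y : V →ₗ[ZMod p] V) b = b + β • m ∧ (α ≠ 0 ∨ β ≠ 0) := by
    obtain ⟨r, s, t, hxb⟩ := exists_coords hdim ha hma hfa hfm hfb ((x : V →ₗ[ZMod p] V) b)
    have ht : t = 1 := by
      have := congrArg f hxb
      simpa [hxf, hfa, hfm, hfb] using this
    obtain ⟨α, hα⟩ := hxker m hfm
    obtain ⟨z, hz, hzv⟩ := haf.smul_right hfa (-(r / f b))
    refine ⟨z * x, G.mul_mem hz hxG, by simp [hxa, hzv, hfa], α, by simp [hzv, hfa, hfm, hα],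
      s, ?_, ?_⟩
    · rw [Units.val_mul, Module.End.mul_apply, hzv, LinearMap.smul_apply, hxf, hxb, ht,
        smul_eq_mul, neg_mul, div_mul_cancel₀ _ hfb, neg_smul, one_smul]
      abel
    · by_contra! hcon
      refine hx (r / f b) fun v => ?_
      obtain ⟨i, j, k, rfl⟩ := exists_coords hdim ha hma hfa hfm hfb v
      simp only [map_add, map_smul, hxa, hα, hxb, hcon.1, hcon.2, ht, hfa, hfm, smul_eq_mul]
      have : r / f b * (i * 0 + j * 0 + k * f b) = k * r := by
        field_simp; ring
      rw [this]
      module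
  by_cases hα : α = 0
  · have hmf : HasTransvection G m f := by
      have hβ : β ≠ 0 := by simpa [hα] using hαβ
      have h₁ : HasTransvection G m ((β / f b) • f) := by
        refine ⟨y, hyG, fun v => ?_⟩
        obtain ⟨i, j, k, rfl⟩ := exists_coords hdim ha hma hfa hfm hfb v
        simp only [map_add, map_smul, hya, hym, hyb, hα, hfa, hfm, smul_eq_mul,
          LinearMap.smul_apply]
        have : i * (β / f b * 0) + j * (β / f b * 0) + k * (β / f b * f b) = k * β := by
          field_simp; ring
        rw [this]
        module
      have h₂ := h₁.smul_right (by simp [hfm]) (β / f b)⁻¹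
      rwa [smul_smul, inv_mul_cancel₀ (div_ne_zero hβ hfb), one_smul] at h₂
    exact ⟨m, hm0, forall_hasTransvection_of_asymmetric hdim hmf hbg hfm hgb hfb hgm hg0⟩
  by_cases hβ : β = 0
  · obtain ⟨l, hlm, hla⟩ := Submodule.exists_le_ker_of_notMem hma
    have hla : l a = 0 := hla (Submodule.mem_span_singleton_self a)
    let l' : Dual (ZMod p) V := (α / l m) • (l - (l b / f b) • f)
    have hl'a : l' a = 0 := by simp [l', hla, hfa]
    have hl'b : l' b = 0 := by simp [l', hfb]
    have hl'm : l' m = α := by simp [l', hfm, hlm]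
    have hl' : HasTransvection G a l' := by
      refine ⟨y, hyG, fun v => ?_⟩
      obtain ⟨i, j, k, rfl⟩ := exists_coords hdim ha hma hfa hfm hfb v
      simp only [map_add, map_smul, hya, hym, hyb, hβ, hl'a, hl'b, hl'm, smul_eq_mul]
      module
    exact ⟨a, ha, forall_hasTransvection_of_two_axes hdim haf hl' hfa hl'a hfb hl'b
      (fun h => hα (by rw [← hl'm, h, LinearMap.zero_apply]))⟩
  · have hyinv : ∀ v, ((y⁻¹ : LinearMap.GeneralLinearGroup (ZMod p) V) : V →ₗ[ZMod p] V)
        ((y : V →ₗ[ZMod p] V) v) = v := units_inv_apply_self y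
    have h₁ := hbg.conj (G.inv_mem hyG)
    rw [inv_inv] at h₁
    have ha' := hyinv a
    rw [hya] at ha'
    have hm' := hyinv m
    rw [hym, map_add, map_smul, ha'] at hm'
    have hb' := hyinv b
    rw [hyb, map_add, map_smul, eq_sub_of_add_eq hm'] at hb'
    have hb0 : b ≠ 0 := fun h => hfb (by rw [h, map_zero])
    refine ⟨b, hb0, forall_hasTransvection_of_asymmetric hdim hbg h₁ hgb ?_ ?_ ?_ ?_⟩
    · simp [units_apply_inv_self, hgb]
    · rw [eq_sub_of_add_eq hb']
      simp [hgb, hgm, hα, hβ, hga]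
    · simp [hyb, hgb, hgm]
    · intro h
      have := congrArg (fun l : Dual (ZMod p) V => l a) h
      simp [hya, hga] at this

end Dim3

section PSubgroups

variable {p : ℕ} [Fact p.Prime] {V : Type*} [AddCommGroup V] [Module (ZMod p) V]

lemma IsPGroup.exists_mem_ne_zero_fixed {Q : Type*} [Group Q] (hQ : IsPGroup p Q)
    [Module.Finite (ZMod p) V] (ρ : Representation (ZMod p) Q V) {W : Submodule (ZMod p) V}
    (hW : W ≠ ⊥) (hinv : ∀ q, ∀ w ∈ W, ρ q w ∈ W) : ∃ w ∈ W, w ≠ 0 ∧ ∀ q, ρ q w = w := by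
  let _ : MulAction Q W :=
    { smul := fun q w => ⟨ρ q w, hinv q w w.2⟩
      one_smul := fun w => Subtype.ext (by change ρ 1 w = w; simp)
      mul_smul := fun q r w => Subtype.ext (by change ρ (q * r) w = ρ q (ρ r w); simp) }
  have : Finite V := Module.finite_of_finite (ZMod p)
  have hcard : p ∣ Nat.card W := by
    rw [Module.natCard_eq_pow_finrank (K := ZMod p), Nat.card_zmod]
    exact dvd_pow_self p (by rwa [Ne, Submodule.finrank_eq_zero])
  have h0 : (0 : W) ∈ MulAction.fixedPoints Q W := fun q => Subtype.ext (map_zero (ρ q))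
  obtain ⟨w, hw, hw0⟩ := hQ.exists_fixed_point_of_prime_dvd_card_of_fixed_point W hcard h0
  exact ⟨w, w.2, fun h => hw0 (Subtype.ext h.symm), fun q => congrArg Subtype.val (hw q)⟩

variable [Module.Finite (ZMod p) V] {P : Subgroup (LinearMap.GeneralLinearGroup (ZMod p) V)}

lemma IsPGroup.exists_fixed_flag (hP : IsPGroup p P) {W : Submodule (ZMod p) V} (hbot : W ≠ ⊥)
    (htop : W ≠ ⊤) (hinv : ∀ x ∈ P, ∀ w ∈ W, (x : V →ₗ[ZMod p] V) w ∈ W) :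
    ∃ a ∈ W, a ≠ 0 ∧ (∀ x ∈ P, (x : V →ₗ[ZMod p] V) a = a) ∧
      ∃ f : Dual (ZMod p) V, (∀ w ∈ W, f w = 0) ∧ f ≠ 0 ∧
        ∀ x ∈ P, ∀ v, f ((x : V →ₗ[ZMod p] V) v) = f v := by
  let ρ : Representation (ZMod p) P V :=
    (Units.coeHom (V →ₗ[ZMod p] V)).comp P.subtype
  obtain ⟨a, haW, ha0, ha⟩ := hP.exists_mem_ne_zero_fixed ρ hbot fun q => hinv q q.2
  have hW' : W.dualAnnihilator ≠ ⊥ := by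
    rwa [Ne, Submodule.dualAnnihilator_eq_bot_iff]
  obtain ⟨f, hfW, hf0, hf⟩ := hP.exists_mem_ne_zero_fixed ρ.dual hW' fun q f hf => by
    rw [Submodule.mem_dualAnnihilator] at hf ⊢
    exact fun w hw => hf _ (hinv _ (q⁻¹).2 w hw)
  rw [Submodule.mem_dualAnnihilator] at hfW
  refine ⟨a, haW, ha0, fun x hx => ha ⟨x, hx⟩, f, hfW, hf0, fun x hx v => ?_⟩
  have := congrArg (fun l : Dual (ZMod p) V => l v) (hf ⟨x, hx⟩⁻¹)
  rw [Representation.dual_apply, inv_inv] at this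
  exact this

/-- A `p`-subgroup of `GL₃(p)` of order at least `p²` stabilizing a flag contains the transvections
along this flag, and some other element. -/
lemma IsPGroup.hasTransvection_of_fixed_flag (hP : IsPGroup p P)
    (hdim : finrank (ZMod p) V = 3) (hcard : p ^ 2 ≤ Nat.card P) {a : V} {f : Dual (ZMod p) V}
    (ha0 : a ≠ 0) (hf0 : f ≠ 0) (hfa : f a = 0) (ha : ∀ x ∈ P, (x : V →ₗ[ZMod p] V) a = a)
    (hf : ∀ x ∈ P, ∀ v, f ((x : V →ₗ[ZMod p] V) v) = f v) :
    HasTransvection P a f ∧ ∃ x ∈ P,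
      (∀ v, f v = 0 → ∃ c : ZMod p, (x : V →ₗ[ZMod p] V) v = v + c • a) ∧
      ∀ c : ZMod p, ¬ ∀ v, (x : V →ₗ[ZMod p] V) v = v + (c * f v) • a := by
  obtain ⟨m, hfm, hma⟩ := exists_mem_ker_notMem_span_singleton hdim a f
  obtain ⟨b, hfb⟩ : ∃ b, f b ≠ 0 := by
    by_contra! h
    exact hf0 (LinearMap.ext h)
  obtain ⟨l, hlm, hla⟩ := Submodule.exists_le_ker_of_notMem hma
  have hla : l a = 0 := hla (Submodule.mem_span_singleton_self a)
  have hm : ∀ x : P, ∃ α : ZMod p,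
      ((x : LinearMap.GeneralLinearGroup (ZMod p) V) : V →ₗ[ZMod p] V) m = m + α • a := by
    rintro ⟨x, hx⟩
    obtain ⟨r, s, t, hxm⟩ := exists_coords hdim ha0 hma hfa hfm hfb ((x : V →ₗ[ZMod p] V) m)
    have ht : t = 0 := by
      have := congrArg f hxm
      simpa [hf x hx, hfa, hfm, hfb] using this
    have hpow : ∀ n : ℕ, ∃ c : ZMod p,
        ((x ^ n : LinearMap.GeneralLinearGroup (ZMod p) V) : V →ₗ[ZMod p] V) m
          = s ^ n • m + c • a := by
      intro n
      induction n with
      | zero => exact ⟨0, by simp⟩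
      | succ n ih =>
        obtain ⟨c, hc⟩ := ih
        refine ⟨s ^ n * r + c, ?_⟩
        rw [pow_succ', Units.val_mul, Module.End.mul_apply, hc, map_add, map_smul, map_smul, hxm,
          ha x hx, ht]
        module
    obtain ⟨k, hk⟩ := hP ⟨x, hx⟩
    have hk : x ^ p ^ k = 1 := congrArg Subtype.val hk
    obtain ⟨c, hc⟩ := hpow (p ^ k)
    rw [hk, ZMod.pow_card_pow] at hc
    have hs : s = 1 := by
      have := congrArg l hc
      simpa [hla, hlm] using this.symm
    exact ⟨r, by simp [hxm, hs, ht, add_comm]⟩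
  have hb : ∀ x : P, ∃ β γ : ZMod p,
      ((x : LinearMap.GeneralLinearGroup (ZMod p) V) : V →ₗ[ZMod p] V) b
        = b + β • m + γ • a := by
    rintro ⟨x, hx⟩
    obtain ⟨r, s, t, hxb⟩ := exists_coords hdim ha0 hma hfa hfm hfb ((x : V →ₗ[ZMod p] V) b)
    have ht : t = 1 := by
      have := congrArg f hxb
      simpa [hf x hx, hfa, hfm, hfb] using this
    exact ⟨s, r, by simp only [hxb, ht]; module⟩
  choose α hα using hm
  choose β γ hβγ using hb
  have hfixa : ∀ x : P,
      ((x : LinearMap.GeneralLinearGroup (ZMod p) V) : V →ₗ[ZMod p] V) a = a := fun x => ha x x.2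
  have hαmul : ∀ x y : P, α (x * y) = α x + α y := by
    intro x y
    have h := hα (x * y)
    rw [Subgroup.coe_mul, Units.val_mul, Module.End.mul_apply, hα, map_add, map_smul, hfixa, hα,
      add_assoc, ← add_smul] at h
    exact (smul_left_injective _ ha0 (add_left_cancel h)).symm
  have hβγmul : ∀ x y : P, β (x * y) = β x + β y ∧ γ (x * y) = γ x + γ y + α x * β y := by
    intro x y
    have h := hβγ (x * y)
    rw [Subgroup.coe_mul, Units.val_mul, Module.End.mul_apply, hβγ, map_add, map_add, map_smul,
      map_smul, hfixa, hα, hβγ] at h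
    have h₁ : β (x * y) = β x + β y := by
      have h' := congrArg l h
      simp only [map_add, map_smul, hla, smul_eq_mul] at h'
      have : l m * (β (x * y) - (β x + β y)) = 0 := by linear_combination -h'
      exact sub_eq_zero.mp ((mul_eq_zero.mp this).resolve_left hlm)
    refine ⟨h₁, ?_⟩
    rw [h₁] at h
    refine (smul_left_injective _ ha0 (?_ : (γ x + γ y + α x * β y) • a = γ (x * y) • a)).symm
    have h' := sub_eq_zero.mpr h
    refine sub_eq_zero.mp (Eq.trans ?_ h')
    module
  have hform : ∀ x : P, α x = 0 → β x = 0 → ∀ v,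
      ((x : LinearMap.GeneralLinearGroup (ZMod p) V) : V →ₗ[ZMod p] V) v
        = v + (γ x / f b * f v) • a := by
    intro x hαx hβx v
    obtain ⟨i, j, k, rfl⟩ := exists_coords hdim ha0 hma hfa hfm hfb v
    simp only [map_add, map_smul, hfixa, hα, hβγ, hαx, hβx, hfa, hfm, smul_eq_mul]
    have : γ x / f b * (i * 0 + j * 0 + k * f b) = k * γ x := by
      field_simp; ring
    rw [this]
    module
  have hex : ∃ z : P, α z = 0 ∧ β z = 0 ∧ γ z ≠ 0 := by
    by_contra! h
    let φ : P →* Multiplicative (ZMod p × ZMod p) :=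
      MonoidHom.mk' (fun x => Multiplicative.ofAdd (α x, β x)) fun x y => by
        rw [hαmul, (hβγmul x y).1]
        rfl
    have hφ : Function.Injective φ := by
      rw [injective_iff_map_eq_one]
      intro x hx
      have hαx : α x = 0 := congrArg (fun t => (Multiplicative.toAdd t).1) hx
      have hβx : β x = 0 := congrArg (fun t => (Multiplicative.toAdd t).2) hx
      refine Subtype.ext (Units.ext (LinearMap.ext fun v => ?_))
      simp [hform x hαx hβx, h x hαx hβx]
    have hbij : Function.Bijective φ := by
      refine hφ.bijective_of_nat_card_le ?_
      simpa [Nat.card_prod, sq] using hcard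
    obtain ⟨x, hx⟩ := hbij.2 (Multiplicative.ofAdd (1, 0))
    obtain ⟨y, hy⟩ := hbij.2 (Multiplicative.ofAdd (0, 1))
    have hαx : α x = 1 := congrArg (fun t => (Multiplicative.toAdd t).1) hx
    have hβx : β x = 0 := congrArg (fun t => (Multiplicative.toAdd t).2) hx
    have hαy : α y = 0 := congrArg (fun t => (Multiplicative.toAdd t).1) hy
    have hβy : β y = 1 := congrArg (fun t => (Multiplicative.toAdd t).2) hy
    have hxy : x * y = y * x := hφ (by rw [map_mul, map_mul, mul_comm])
    have h₁ := (hβγmul x y).2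
    rw [hxy, (hβγmul y x).2, hαx, hβx, hαy, hβy] at h₁
    have : (1 : ZMod p) = 0 := by linear_combination -h₁
    exact one_ne_zero this
  refine ⟨?_, ?_⟩
  · obtain ⟨z, hαz, hβz, hγz⟩ := hex
    have h₁ : HasTransvection P a ((γ z / f b) • f) := ⟨z, z.2, hform z hαz hβz⟩
    have h₂ := h₁.smul_right (by simp [hfa]) (γ z / f b)⁻¹
    rwa [smul_smul, inv_mul_cancel₀ (div_ne_zero hγz hfb), one_smul] at h₂
  · obtain ⟨x, hx⟩ : ∃ x : P, α x ≠ 0 ∨ β x ≠ 0 := by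
      by_contra! h
      have hinj : Function.Injective γ := by
        intro x y hxy
        refine Subtype.ext (Units.ext (LinearMap.ext fun v => ?_))
        rw [hform x (h x).1 (h x).2, hform y (h y).1 (h y).2, hxy]
      have h₁ := Nat.card_le_card_of_injective γ hinj
      rw [Nat.card_zmod] at h₁
      have h₂ : p * p ≤ p * 1 := by
        rw [← sq, mul_one]
        exact hcard.trans h₁
      have := Nat.le_of_mul_le_mul_left h₂ (Fact.out : p.Prime).pos
      exact absurd (Fact.out : p.Prime).one_lt (by omega)
    refine ⟨x, x.2, fun v hv => ?_, fun c hc => ?_⟩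
    · obtain ⟨i, j, k, rfl⟩ := exists_coords hdim ha0 hma hfa hfm hfb v
      have hk : k = 0 := by simpa [hfa, hfm, hfb] using hv
      refine ⟨j * α x, ?_⟩
      simp only [map_add, map_smul, hfixa, hα, hk]
      module
    · have hαx : α x = 0 := by
        have := hc m
        rw [hα, hfm] at this
        simpa [ha0] using this
      have hβx : β x = 0 := by
        have := congrArg l (hc b)
        rw [hβγ] at this
        simpa [hla, hlm] using this
      simp [hαx, hβx] at hx

end PSubgroups

section Main

variable {p : ℕ} [Fact p.Prime] {V : Type*} [AddCommGroup V] [Module (ZMod p) V]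

/-- The elements of `G` acting trivially on `W` and on `V ⧸ W`. -/
def unipotentRadical {K V : Type*} [Field K] [AddCommGroup V] [Module K V]
    (G : Subgroup (LinearMap.GeneralLinearGroup K V)) (W : Submodule K V) : Subgroup G where
  carrier := {g | (∀ w ∈ W, ((g : LinearMap.GeneralLinearGroup K V) : V →ₗ[K] V) w = w) ∧
    ∀ v, ((g : LinearMap.GeneralLinearGroup K V) : V →ₗ[K] V) v - v ∈ W}
  one_mem' := by simp
  mul_mem' := by
    rintro g h ⟨hg, hg'⟩ ⟨hh, hh'⟩
    refine ⟨fun w hw => by simp [hh w hw, hg w hw], fun v => ?_⟩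
    simpa using W.add_mem (hg' (((h : LinearMap.GeneralLinearGroup K V) : V →ₗ[K] V) v)) (hh' v)
  inv_mem' := by
    rintro g ⟨hg, hg'⟩
    refine ⟨fun w hw => ?_, fun v => ?_⟩
    · conv_lhs => rw [← hg w hw]
      exact units_inv_apply_self _ w
    · have := hg' ((((g⁻¹ : G) : LinearMap.GeneralLinearGroup K V) : V →ₗ[K] V) v)
      rw [Subgroup.coe_inv, units_apply_inv_self] at this
      rw [← neg_sub]
      exact W.neg_mem this

lemma unipotentRadical_normal {K V : Type*} [Field K] [AddCommGroup V] [Module K V]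
    {G : Subgroup (LinearMap.GeneralLinearGroup K V)} {W : Submodule K V}
    (hinv : ∀ g ∈ G, ∀ w ∈ W, (g : V →ₗ[K] V) w ∈ W) : (unipotentRadical G W).Normal := by
  refine ⟨?_⟩
  rintro ⟨n, hnG⟩ ⟨hn, hn'⟩ ⟨g, hg⟩
  refine ⟨fun w hw => ?_, fun v => ?_⟩
  · have := hn _ (hinv _ (G.inv_mem hg) w hw)
    simp only [Subgroup.coe_mul, Subgroup.coe_inv, Units.val_mul, Module.End.mul_apply] at this ⊢
    rw [this, units_apply_inv_self]
  · have := hinv g hg _ (hn' (((g⁻¹ : LinearMap.GeneralLinearGroup K V) : V →ₗ[K] V) v))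
    rw [map_sub, units_apply_inv_self] at this
    exact this

lemma isPGroup_unipotentRadical (G : Subgroup (LinearMap.GeneralLinearGroup (ZMod p) V))
    (W : Submodule (ZMod p) V) : IsPGroup p (unipotentRadical G W) := by
  rintro ⟨⟨g, hgG⟩, hg, hg'⟩
  refine ⟨1, Subtype.ext (Subtype.ext (Units.ext (LinearMap.ext fun v => ?_)))⟩
  have key : ∀ n : ℕ, ((g ^ n : LinearMap.GeneralLinearGroup (ZMod p) V) : V →ₗ[ZMod p] V) v
      = v + (n : ZMod p) • ((g : V →ₗ[ZMod p] V) v - v) := by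
    intro n
    induction n with
    | zero => simp
    | succ n ih =>
      rw [pow_succ', Units.val_mul, Module.End.mul_apply, ih, map_add, map_smul, hg _ (hg' v),
        Nat.cast_succ]
      module
  have := key p
  simpa using this

variable [Module.Finite (ZMod p) V]

/-- If `G ≤ GL₃(p)` has no nontrivial normal
`p`-subgroup and contains a `p`-subgroup of order at least `p²`, then it is irreducible. -/
lemma eq_bot_or_eq_top_of_invariant (hdim : finrank (ZMod p) V = 3)
    {G P : Subgroup (LinearMap.GeneralLinearGroup (ZMod p) V)}
    (hG : ∀ N : Subgroup G, N.Normal → IsPGroup p N → N = ⊥) (hPG : P ≤ G) (hP : IsPGroup p P)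
    (hcard : p ^ 2 ≤ Nat.card P) (W : Submodule (ZMod p) V)
    (hinv : ∀ g ∈ G, ∀ w ∈ W, (g : V →ₗ[ZMod p] V) w ∈ W) : W = ⊥ ∨ W = ⊤ := by
  by_contra! h
  obtain ⟨a, haW, ha0, ha, f, hfW, hf0, hf⟩ :=
    hP.exists_fixed_flag h.1 h.2 fun x hx => hinv x (hPG hx)
  obtain ⟨t, ht, htv⟩ :=
    (hP.hasTransvection_of_fixed_flag hdim hcard ha0 hf0 (hfW a haW) ha hf).1
  have htN : (⟨t, hPG ht⟩ : G) ∈ unipotentRadical G W :=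
    ⟨fun w hw => by simp [htv, hfW w hw], fun v => by simpa [htv] using W.smul_mem _ haW⟩
  rw [hG _ (unipotentRadical_normal hinv) (isPGroup_unipotentRadical G W), Subgroup.mem_bot] at htN
  have ht1 : t = 1 := congrArg Subtype.val htN
  refine hf0 (LinearMap.ext fun v => ?_)
  have := htv v
  simpa [ht1, ha0] using this

lemma ker_det_le_of_sq_le_card (hdim : finrank (ZMod p) V = 3)
    {G P : Subgroup (LinearMap.GeneralLinearGroup (ZMod p) V)}
    (hG : ∀ N : Subgroup G, N.Normal → IsPGroup p N → N = ⊥) (hPG : P ≤ G) (hP : IsPGroup p P)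
    (hcard : p ^ 2 ≤ Nat.card P) :
    (Units.map (LinearMap.det : (V →ₗ[ZMod p] V) →* ZMod p)).ker ≤ G := by
  have : Nontrivial V := Module.nontrivial_of_finrank_pos (R := ZMod p) (by omega)
  have hirr := eq_bot_or_eq_top_of_invariant hdim hG hPG hP hcard
  obtain ⟨c, -, hc0, hc⟩ := hP.exists_mem_ne_zero_fixed
    ((Units.coeHom (V →ₗ[ZMod p] V)).comp P.subtype) top_ne_bot fun _ _ _ => Submodule.mem_top
  have htop : Submodule.span (ZMod p) {c} ≠ ⊤ := by
    intro h
    have := finrank_span_singleton (K := ZMod p) hc0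
    rw [h, finrank_top, hdim] at this
    omega
  obtain ⟨a, haW, ha0, ha, f, hfW, hf0, hf⟩ :=
    hP.exists_fixed_flag (mt Submodule.span_singleton_eq_bot.mp hc0) htop fun x hx w hw => by
      obtain ⟨r, rfl⟩ := Submodule.mem_span_singleton.mp hw
      rw [map_smul, show (x : V →ₗ[ZMod p] V) c = c from hc ⟨x, hx⟩]
      exact hw
  obtain ⟨haf, x, hx, hxker, hxne⟩ :=
    hP.hasTransvection_of_fixed_flag hdim hcard ha0 hf0 (hfW a haW) ha hf
  exact ker_det_le_of_forall_hasTransvection (by omega) <|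
    forall_hasTransvection_of_unipotent hdim hirr ha0 hf0 (hfW a haW) (haf.mono hPG) (hPG hx)
      (ha x hx) (hf x hx) hxker hxne

lemma pow_three_dvd_card_ker_det (hdim : finrank (ZMod p) V = 3) :
    p ^ 3 ∣ Nat.card (Units.map (LinearMap.det : (V →ₗ[ZMod p] V) →* ZMod p)).ker := by
  let b := Module.finBasisOfFinrankEq (ZMod p) V hdim
  have hcard : Nat.card (LinearMap.GeneralLinearGroup (ZMod p) V) =
      (p ^ 3 - 1) * (p ^ 3 - p) * (p ^ 3 - p ^ 2) := by
    rw [Nat.card_congr (Units.mapEquiv (LinearMap.toMatrixAlgEquiv b).toMulEquiv).toEquiv]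
    have := Matrix.card_GL_field (𝔽 := ZMod p) 3
    simpa [Fin.prod_univ_three] using this
  have hdvd : p ^ 3 ∣ Nat.card (LinearMap.GeneralLinearGroup (ZMod p) V) := by
    have h₁ : p ^ 3 - p = p * (p ^ 2 - 1) := by rw [Nat.mul_sub, mul_one, ← pow_succ']
    have h₂ : p ^ 3 - p ^ 2 = p ^ 2 * (p - 1) := by rw [Nat.mul_sub, mul_one, ← pow_succ]
    rw [hcard, h₁, h₂]
    exact ⟨(p ^ 3 - 1) * (p ^ 2 - 1) * (p - 1), by ring⟩
  set d := Units.map (LinearMap.det : (V →ₗ[ZMod p] V) →* ZMod p)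
  rw [← Subgroup.card_mul_index d.ker, Subgroup.index_ker] at hdvd
  refine (Nat.Coprime.pow_left 3 ?_).dvd_of_dvd_mul_right hdvd
  have hrange : Nat.card d.range ∣ p - 1 := by
    have := Subgroup.card_subgroup_dvd_card d.range
    rwa [Nat.card_eq_fintype_card (α := (ZMod p)ˣ), ZMod.card_units] at this
  have hp : p.Prime := Fact.out
  refine Nat.Coprime.coprime_dvd_right hrange ?_
  exact (Nat.coprime_self_sub_right hp.one_le).mpr (Nat.coprime_one_right p)

end Main

/-- **Statement 14.** Let `p` be a prime, `V` a `3`-dimensional vector space over `F_p` and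
`G ≤ GL(V)` a subgroup with no nontrivial normal `p`-subgroup. Then the order of a Sylow
`p`-subgroup of `G` is not `p²`, and if the order of a Sylow `p`-subgroup of `G` is `p³`,
then `G` contains `SL(V)` (the subgroup of automorphisms of determinant `1`). -/
theorem stmt14 (p : ℕ) [Fact p.Prime] (V : Type*) [AddCommGroup V] [Module (ZMod p) V]
    [Module.Finite (ZMod p) V] (hdim : Module.finrank (ZMod p) V = 3)
    (G : Subgroup (LinearMap.GeneralLinearGroup (ZMod p) V))
    (hG : ∀ N : Subgroup G, N.Normal → IsPGroup p N → N = ⊥) :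
    (∀ P : Sylow p G, Nat.card ↥(P : Subgroup G) ≠ p ^ 2) ∧
    ((∀ P : Sylow p G, Nat.card ↥(P : Subgroup G) = p ^ 3) →
      (Units.map (LinearMap.det : (V →ₗ[ZMod p] V) →* ZMod p)).ker ≤ G) := by
  have hV : Finite V := Module.finite_of_finite (ZMod p)
  have hE : Finite (V →ₗ[ZMod p] V) := Module.finite_of_finite (ZMod p)
  have hmain : ∀ P : Sylow p G, p ^ 2 ≤ Nat.card ↥(P : Subgroup G) →
      (Units.map (LinearMap.det : (V →ₗ[ZMod p] V) →* ZMod p)).ker ≤ G := by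
    intro P hP
    refine ker_det_le_of_sq_le_card hdim hG (P := (P : Subgroup G).map G.subtype)
      (Subgroup.map_subtype_le _) (P.isPGroup'.map _) ?_
    rwa [Subgroup.card_map_of_injective G.subtype_injective]
  have hp : 1 < p := (Fact.out : p.Prime).one_lt
  refine ⟨fun P hP => ?_, fun hP => ?_⟩
  · have hdvd := P.pow_dvd_card_of_pow_dvd_card
      ((pow_three_dvd_card_ker_det hdim).trans (Subgroup.card_dvd_of_le (hmain P hP.ge)))
    rw [hP, Nat.pow_dvd_pow_iff_le_right hp] at hdvd
    omega
  · have P : Sylow p G := default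
    exact hmain P ((hP P).symm ▸ Nat.pow_le_pow_right hp.le (by omega))
end

section
/- Let p ≥ 5 be a prime and let S be a finite group of order p⁶ possessing a normal subgroup Q of index p which is extraspecial of order p⁵ and exponent p, and such that the derived subgroup [S,S] has index p² in S. Then the number of conjugacy classes of S equals p³ + 2p² − p − 1. -/
open scoped commutatorElement

namespace Subgroup

variable {G : Type*} [Group G]

theorem eq_top_of_index_prime_of_not_le {A H : Subgroup G} (hA : A.index.Prime) (hAH : A ≤ H)
    (hHA : ¬ H ≤ A) : H = ⊤ := by
  have h := relIndex_mul_index hAH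
  obtain h1 | h1 := (Nat.dvd_prime hA).1 (Dvd.intro_left _ h)
  · exact index_eq_one.1 h1
  · rw [h1] at h
    have h2 : A.relIndex H = 1 := Nat.eq_of_mul_eq_mul_right hA.pos (h.trans (one_mul _).symm)
    exact (hHA (relIndex_eq_one.1 h2)).elim

end Subgroup

open Subgroup in
theorem card_inf_mul_index_of_not_le {G : Type*} [Group G] {H K : Subgroup G} [K.Normal]
    (hK : K.index.Prime) (hHK : ¬ H ≤ K) :
    Nat.card (H ⊓ K : Subgroup G) * K.index = Nat.card H := by
  have h1 : K.relIndex H = K.index := by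
    rw [← relIndex_sup_right, eq_top_of_index_prime_of_not_le hK le_sup_right
      fun h => hHK (le_sup_left.trans h), relIndex_top_right]
  have h2 := relIndex_mul_relIndex ⊥ (H ⊓ K) H bot_le inf_le_left
  rwa [relIndex_bot_left, relIndex_bot_left, inf_relIndex_left, h1] at h2

open Subgroup in
/-- If `k ↦ ⁅k, w⁆` sends `K` into a central subgroup of prime order and is not trivial, then it
is a homomorphism onto that subgroup whose kernel is the centralizer of `w` in `K`. -/
theorem card_centralizer_inf_mul_of_commutator_mem {G : Type*} [Group G] {K N : Subgroup G}
    {w k₀ : G} (hN : (Nat.card N).Prime) (hNc : N ≤ center G) (hw : ∀ k ∈ K, ⁅k, w⁆ ∈ N)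
    (hk₀ : k₀ ∈ K) (hne : ⁅k₀, w⁆ ≠ 1) :
    Nat.card (centralizer {w} ⊓ K : Subgroup G) * Nat.card N = Nat.card K := by
  let f : K →* N := MonoidHom.mk' (fun k => ⟨⁅(k : G), w⁆, hw k k.2⟩) fun a b => by
    have hb := mem_center_iff.1 (hNc (hw b b.2)) a
    have hab := mem_center_iff.1 (hNc (hw b b.2)) ⁅(a : G), w⁆
    refine Subtype.ext ?_
    simp only [coe_mul, commutatorElement_def] at hb hab ⊢
    rw [hab, ← mul_inv_eq_iff_eq_mul.2 hb]
    group
  have hf : f.ker = (centralizer {w}).subgroupOf K := by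
    ext x
    rw [MonoidHom.mem_ker, mem_subgroupOf, mem_centralizer_singleton_iff,
      ← commutatorElement_eq_one_iff_mul_comm]
    exact Subtype.ext_iff
  have hrange : f.range = ⊤ := by
    have := Fact.mk hN
    refine (eq_bot_or_eq_top_of_prime_card f.range).resolve_left fun h => hne ?_
    have : f ⟨k₀, hk₀⟩ ∈ (⊥ : Subgroup N) := h ▸ ⟨_, rfl⟩
    exact congrArg Subtype.val (mem_bot.1 this)
  have h := card_mul_index f.ker
  rw [index_ker, hrange, card_top, hf, ← inf_subgroupOf_right] at h
  rwa [Nat.card_congr (subgroupOfEquivOfLe inf_le_right).toEquiv] at h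

open Subgroup in
/-- If `A` is an abelian normal subgroup of prime index and `s ∉ A`, then `a ↦ ⁅a, s⁆` is a
homomorphism from `A` onto the derived subgroup. -/
theorem card_centralizer_inf_mul_card_commutator {G : Type*} [Group G] {A : Subgroup G} [A.Normal]
    (hA : A.index.Prime) (hcomm : ∀ a ∈ A, ∀ b ∈ A, a * b = b * a) {s : G} (hs : s ∉ A) :
    Nat.card (centralizer {s} ⊓ A : Subgroup G) * Nat.card (commutator G) = Nat.card A := by
  have hmem : ∀ a ∈ A, ⁅a, s⁆ ∈ A := fun a ha => by
    rw [commutatorElement_def, mul_assoc, mul_assoc, ← mul_assoc s]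
    exact mul_mem ha (Normal.conj_mem ‹_› _ (inv_mem ha) s)
  let f : A →* G := MonoidHom.mk' (fun a => ⁅(a : G), s⁆) fun a b => by
    have hab := hcomm _ (hmem b b.2) _ (inv_mem a.2)
    have hab' := hcomm _ a.2 _ (hmem b b.2)
    have : ⁅(a : G) * b, s⁆ = a * ⁅(b : G), s⁆ * (a : G)⁻¹ * ⁅(a : G), s⁆ := by
      simp only [commutatorElement_def]
      group
    rw [coe_mul, this, hab', mul_inv_cancel_right, hcomm _ (hmem b b.2) _ (hmem a a.2)]
  have hker : f.ker = (centralizer {s}).subgroupOf A := by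
    ext x
    rw [MonoidHom.mem_ker, mem_subgroupOf, mem_centralizer_singleton_iff,
      ← commutatorElement_eq_one_iff_mul_comm]
    rfl
  have hfA : f.range ≤ A := by
    rintro _ ⟨a, rfl⟩
    exact hmem a a.2
  have hnormal : f.range.Normal := by
    refine normalizer_eq_top_iff.1 ?_
    have hsn : s ∈ normalizer (f.range : Set G) := by
      refine mem_normalizer_iff.2 fun h => ⟨?_, ?_⟩
      · rintro ⟨a, rfl⟩
        refine ⟨⟨s * a * s⁻¹, Normal.conj_mem ‹_› _ a.2 s⟩, ?_⟩
        change ⁅s * (a : G) * s⁻¹, s⁆ = s * ⁅(a : G), s⁆ * s⁻¹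
        simp only [commutatorElement_def]
        group
      · rintro ⟨a, ha⟩
        refine ⟨⟨s⁻¹ * a * s, Normal.conj_mem' ‹_› _ a.2 s⟩, ?_⟩
        change ⁅(a : G), s⁆ = s * h * s⁻¹ at ha
        change ⁅s⁻¹ * (a : G) * s, s⁆ = h
        rw [← mul_right_inj s, ← mul_left_inj s⁻¹, ← ha]
        simp only [commutatorElement_def]
        group
    exact eq_top_of_index_prime_of_not_le hA
      (fun a ha => centralizer_le_normalizer _ fun r hr => (hcomm a ha r (hfA hr)).symm)
      fun h => hs (h hsn)
  have hrange : f.range = commutator G := by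
    refine le_antisymm ?_ ?_
    · rintro _ ⟨a, rfl⟩
      exact commutator_mem_commutator (mem_top _) (mem_top _)
    let π := QuotientGroup.mk' f.range
    have hsA : ∀ a ∈ A, π a * π s = π s * π a := fun a ha => by
      rw [← commutatorElement_eq_one_iff_mul_comm, ← map_commutatorElement]
      exact (QuotientGroup.eq_one_iff _).2 ⟨⟨a, ha⟩, rfl⟩
    have hscent : (centralizer {π s}).comap π = ⊤ :=
      eq_top_of_index_prime_of_not_le hA
        (fun a ha => mem_centralizer_singleton_iff.2 (hsA a ha))
        fun h => hs (h (mem_centralizer_singleton_iff.2 rfl))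
    have hacent : ∀ a ∈ A, (centralizer {π a}).comap π = ⊤ := fun a ha =>
      eq_top_of_index_prime_of_not_le hA
        (fun b hb => mem_centralizer_singleton_iff.2 (by
          rw [← map_mul, hcomm b hb a ha, map_mul]))
        fun h => hs (h (mem_centralizer_singleton_iff.2 (hsA a ha).symm))
    have htop : (center (G ⧸ f.range)).comap π = ⊤ := by
      have hcenter : ∀ x, (centralizer {π x}).comap π = ⊤ → x ∈ (center _).comap π := by
        intro x hx
        refine mem_center_iff.2 fun y => ?_
        obtain ⟨y, rfl⟩ := QuotientGroup.mk'_surjective _ y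
        exact mem_centralizer_singleton_iff.1 (hx ▸ mem_top y : y ∈ (centralizer {π x}).comap π)
      exact eq_top_of_index_prime_of_not_le hA (fun a ha => hcenter a (hacent a ha))
        fun h => hs (h (hcenter s hscent))
    rw [_root_.commutator_def, commutator_le]
    intro x _ y _
    rw [← QuotientGroup.eq_one_iff, ← QuotientGroup.mk'_apply, map_commutatorElement,
      commutatorElement_eq_one_iff_mul_comm]
    exact mem_center_iff.1 (htop ▸ mem_top y : y ∈ (center _).comap π) _
  have h := card_mul_index f.ker
  rw [index_ker, hrange, hker, ← inf_subgroupOf_right] at h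
  rwa [Nat.card_congr (subgroupOfEquivOfLe inf_le_right).toEquiv] at h

open Subgroup in
theorem centralizer_inf_eq_center_of_card_ne {G : Type*} [Group G] {A : Subgroup G} [A.Normal]
    [Finite G] (hA : A.index.Prime) (hcomm : ∀ a ∈ A, ∀ b ∈ A, a * b = b * a) {s : G} (hs : s ∉ A)
    (hne : Nat.card (commutator G) ≠ 1) : centralizer {s} ⊓ A = center G := by
  refine le_antisymm ?_ (le_inf (center_le_centralizer _) fun g hg => ?_)
  · rintro a ⟨ha, haA⟩
    have htop : centralizer {a} = ⊤ := eq_top_of_index_prime_of_not_le hA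
      (fun b hb => mem_centralizer_singleton_iff.2 (hcomm b hb a haA))
      fun h => hs (h (mem_centralizer_singleton_iff.2 (mem_centralizer_singleton_iff.1 ha).symm))
    exact mem_center_iff.2 fun y =>
      mem_centralizer_singleton_iff.1 (htop ▸ mem_top y : y ∈ centralizer {a})
  · by_contra hgA
    have h := card_centralizer_inf_mul_card_commutator hA hcomm hgA
    have htop : centralizer {g} ⊓ A = A := inf_eq_right.2 fun a _ =>
      mem_centralizer_singleton_iff.2 (mem_center_iff.1 hg a)
    rw [htop] at h
    exact hne (Nat.eq_of_mul_eq_mul_left Nat.card_pos (h.trans (mul_one _).symm))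

open Subgroup in
theorem IsPGroup.normal_le_center_of_card_eq {p : ℕ} [Fact p.Prime] {G : Type*} [Group G]
    [Finite G] (hG : IsPGroup p G) {N : Subgroup G} [N.Normal] (hN : Nat.card N = p) :
    N ≤ center G := by
  have hG' : IsPGroup p (ConjAct G) := hG.of_equiv ConjAct.toConjAct
  obtain ⟨b, hb, hb1⟩ := hG'.exists_fixed_point_of_prime_dvd_card_of_fixed_point N hN.symm.dvd
    (a := 1) fun g => smul_one g
  have : Fact (Nat.card N).Prime := by rwa [hN]
  rw [← subgroupOf_eq_top]
  refine (eq_bot_or_eq_top_of_prime_card _).resolve_left fun h => hb1 ?_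
  have hmem : b ∈ (center G).subgroupOf N := by
    refine mem_center_iff.2 fun g => ?_
    have := congrArg Subtype.val (hb (ConjAct.toConjAct g))
    rw [ConjAct.Subgroup.val_conj_smul, ConjAct.toConjAct_smul] at this
    exact mul_inv_eq_iff_eq_mul.1 this
  exact (mem_bot.1 (h ▸ hmem)).symm

theorem sum_card_centralizer_eq (G : Type*) [Group G] [Fintype G] :
    ∑ g : G, Nat.card (Subgroup.centralizer {g}) = Nat.card (ConjClasses G) * Nat.card G := by
  rw [← card_comm_eq_card_conjClasses_mul_card, ← Nat.card_sigma]
  refine Nat.card_congr ⟨fun x => ⟨(x.2, x.1), Subgroup.mem_centralizer_singleton_iff.1 x.2.2⟩,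
    fun x => ⟨x.1.2, x.1.1, Subgroup.mem_centralizer_singleton_iff.2 x.2⟩,
    fun _ => rfl, fun _ => rfl⟩

open Classical in
theorem sum_ite_mem_subgroup {G : Type*} [Group G] [Fintype G] (H : Subgroup G) (c : ℤ) :
    ∑ g : G, (if g ∈ H then c else 0) = Nat.card H * c := by
  rw [← Finset.sum_filter, Finset.sum_const, nsmul_eq_mul, Nat.card_eq_fintype_card,
    Fintype.card_subtype]

/-- **Statement 19.** Let `p ≥ 5` be a prime and `S` a finite group of order `p⁶` with a
normal subgroup `Q` of index `p` which is extraspecial of order `p⁵` and exponent `p`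
(its center, derived subgroup and Frattini subgroup coincide and have order `p`), and such
that the derived subgroup `[S,S]` has index `p²` in `S`. Then the number of conjugacy
classes of `S` equals `p³ + 2p² − p − 1`. -/
theorem stmt19 (p : ℕ) [Fact p.Prime] (hp : 5 ≤ p)
    (S : Type*) [Group S] (hScard : Nat.card S = p ^ 6)
    (Q : Subgroup S) [Q.Normal] (hQidx : Q.index = p)
    (hQcard : Nat.card Q = p ^ 5)
    (hQzc : Subgroup.center Q = commutator Q)
    (hQcf : commutator Q = frattini Q)
    (hQz : Nat.card (Subgroup.center Q) = p)
    (hQexp : Monoid.exponent Q = p)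
    (hScomm : (commutator S).index = p ^ 2) :
    Nat.card (ConjClasses S) = p ^ 3 + 2 * p ^ 2 - p - 1 := by
  have hp1 : p.Prime := Fact.out
  have : Finite S := Nat.finite_of_card_ne_zero (by rw [hScard]; positivity)
  set Z : Subgroup S := (Subgroup.center Q).map Q.subtype with hZdef
  have hZcard : Nat.card Z = p := by
    rw [← hQz]
    exact Subgroup.card_map_of_injective Q.subtype_injective
  have hZQ : Z ≤ Q := Subgroup.map_subtype_le _
  have hZ_iff : ∀ x, x ∈ Z ↔ x ∈ Q ∧ ∀ y ∈ Q, y * x = x * y := by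
    intro x
    constructor
    · rintro ⟨x, hx, rfl⟩
      exact ⟨x.2, fun y hy => congrArg Subtype.val (Subgroup.mem_center_iff.1 hx ⟨y, hy⟩)⟩
    · rintro ⟨hx, h⟩
      exact ⟨⟨x, hx⟩, Subgroup.mem_center_iff.2 fun y => Subtype.ext (h y y.2), rfl⟩
  have hcommQ : ∀ x ∈ Q, ∀ y ∈ Q, ⁅x, y⁆ ∈ Z := by
    intro x hx y hy
    refine ⟨⁅(⟨x, hx⟩ : Q), (⟨y, hy⟩ : Q)⁆, ?_, rfl⟩
    rw [hQzc]
    exact Subgroup.commutator_mem_commutator (Subgroup.mem_top _) (Subgroup.mem_top _)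
  have hZcomm : Z ≤ commutator S := by
    rw [hZdef, hQzc, commutator_def, commutator_def, Subgroup.map_commutator]
    exact Subgroup.commutator_mono le_top le_top
  have hZnormal : Z.Normal := inferInstanceAs ((Subgroup.center Q).map Q.subtype).Normal
  have hZcenter : Z ≤ Subgroup.center S :=
    (IsPGroup.of_card hScard).normal_le_center_of_card_eq hZcard
  set π := QuotientGroup.mk' Z
  have hπs : Function.Surjective π := QuotientGroup.mk'_surjective Z
  have hker : π.ker = Z := QuotientGroup.ker_mk' Z
  have hπ1 : ∀ x, π x = 1 ↔ x ∈ Z := fun x => QuotientGroup.eq_one_iff x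
  set A : Subgroup (S ⧸ Z) := Q.map π with hA
  have hcomapA : A.comap π = Q := by
    rw [hA, Subgroup.comap_map_eq, hker, sup_eq_left.2 hZQ]
  have hmemA : ∀ x, π x ∈ A ↔ x ∈ Q := fun x => by rw [← Subgroup.mem_comap, hcomapA]
  have hGcard : Nat.card (S ⧸ Z) = p ^ 5 := by
    have h := Subgroup.card_mul_index Z
    rw [hZcard, hScard, Subgroup.index] at h
    exact Nat.eq_of_mul_eq_mul_left hp1.pos (h.trans (by ring))
  have hAidx : A.index = p := by
    rw [← hQidx, ← hcomapA, Subgroup.index_comap_of_surjective _ hπs]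
  have hAnormal : A.Normal := Subgroup.Normal.map ‹_› π hπs
  have hAcard : Nat.card A = p * p ^ 3 := by
    have h := Subgroup.card_mul_index A
    rw [hAidx, hGcard] at h
    exact Nat.eq_of_mul_eq_mul_right hp1.pos (h.trans (by ring))
  have hAcomm : ∀ a ∈ A, ∀ b ∈ A, a * b = b * a := by
    rintro _ ⟨a, ha, rfl⟩ _ ⟨b, hb, rfl⟩
    rw [← commutatorElement_eq_one_iff_mul_comm, ← map_commutatorElement, hπ1]
    exact hcommQ a ha b hb
  have hGcomm : Nat.card (commutator (S ⧸ Z)) = p ^ 3 := by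
    have h1 : (commutator (S ⧸ Z)).index = p ^ 2 := by
      have : commutator (S ⧸ Z) = (commutator S).map π := by
        rw [commutator_def, commutator_def, Subgroup.map_commutator,
          Subgroup.map_top_of_surjective _ hπs]
      rw [this, Subgroup.index_map, hker, sup_eq_left.2 hZcomm, hScomm,
        MonoidHom.range_eq_top.2 hπs, Subgroup.index_top, mul_one]
    have h := Subgroup.card_mul_index (commutator (S ⧸ Z))
    rw [h1, hGcard] at h
    exact Nat.eq_of_mul_eq_mul_right (pow_pos hp1.pos 2) (h.trans (by ring))
  have hAnle : ¬ (⊤ : Subgroup (S ⧸ Z)) ≤ A := by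
    intro h
    rw [top_le_iff.1 h, Subgroup.index_top] at hAidx
    exact hp1.one_lt.ne hAidx
  have hcent : ∀ s ∉ A, Subgroup.centralizer {s} ⊓ A = Subgroup.center (S ⧸ Z) := by
    intro s hs
    refine centralizer_inf_eq_center_of_card_ne (hAidx ▸ hp1) hAcomm hs ?_
    rw [hGcomm]
    exact (Nat.one_lt_pow (by norm_num) hp1.one_lt).ne'
  obtain ⟨s₀, -, hs₀⟩ := SetLike.not_le_iff_exists.1 hAnle
  have hcenter_le : Subgroup.center (S ⧸ Z) ≤ A := hcent s₀ hs₀ ▸ inf_le_right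
  have hcenter_card : Nat.card (Subgroup.center (S ⧸ Z)) = p := by
    have h := card_centralizer_inf_mul_card_commutator (hAidx ▸ hp1) hAcomm hs₀
    rw [hcent s₀ hs₀, hGcomm, hAcard] at h
    exact Nat.eq_of_mul_eq_mul_right (pow_pos hp1.pos 3) h
  set W : Subgroup S := (Subgroup.center (S ⧸ Z)).comap π with hW
  have hZW : Z ≤ W := fun z hz => by
    rw [hW, Subgroup.mem_comap, (hπ1 z).2 hz]
    exact one_mem _
  have hWQ : W ≤ Q := hcomapA ▸ Subgroup.comap_mono hcenter_le
  have hWcard : Nat.card W = p ^ 2 := by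
    have h1 := Subgroup.card_mul_index W
    have h2 := Subgroup.card_mul_index (Subgroup.center (S ⧸ Z))
    rw [hW, Subgroup.index_comap_of_surjective _ hπs, ← hW, hScard] at h1
    rw [hcenter_card, hGcard] at h2
    have h3 : (Subgroup.center (S ⧸ Z)).index = p ^ 4 :=
      Nat.eq_of_mul_eq_mul_left hp1.pos (h2.trans (by ring))
    rw [h3] at h1
    exact Nat.eq_of_mul_eq_mul_right (pow_pos hp1.pos 4) (h1.trans (by ring))
  have hWcomm : ∀ w ∈ W, ∀ k : S, ⁅k, w⁆ ∈ Z := by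
    intro w hw k
    rw [← hπ1, map_commutatorElement, commutatorElement_eq_one_iff_mul_comm]
    exact Subgroup.mem_center_iff.1 hw _
  have hCQW : ∀ s ∉ Q, Subgroup.centralizer {s} ⊓ Q ≤ W := by
    rintro s hs x ⟨hx, hxQ⟩
    rw [hW, Subgroup.mem_comap, ← hcent (π s) (by rwa [hmemA])]
    refine ⟨?_, (hmemA x).2 hxQ⟩
    refine Subgroup.mem_centralizer_singleton_iff.2 ?_
    rw [← map_mul, Subgroup.mem_centralizer_singleton_iff.1 hx, map_mul]
  have hZC : ∀ s, Z ≤ Subgroup.centralizer {s} := by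
    intro s z hz
    rw [Subgroup.mem_centralizer_singleton_iff]
    exact (Subgroup.mem_center_iff.1 (hZcenter hz) s).symm
  have hnoncomm : ∀ g ∈ Q, g ∉ Z → ∃ k ∈ Q, ⁅k, g⁆ ≠ 1 := by
    intro g hg hgZ
    by_contra! h
    exact hgZ ((hZ_iff g).2 ⟨hg, fun y hy => commutatorElement_eq_one_iff_mul_comm.1 (h y hy)⟩)
  have hc5 : ∀ w ∈ W, w ∉ Z → Nat.card (Subgroup.centralizer {w}) = p ^ 5 := by
    intro w hw hwZ
    obtain ⟨k, -, hk⟩ := hnoncomm w (hWQ hw) hwZ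
    have h := card_centralizer_inf_mul_of_commutator_mem (K := ⊤) (N := Z) (hZcard ▸ hp1)
      hZcenter (fun k _ => hWcomm w hw k) (Subgroup.mem_top k) hk
    rw [inf_top_eq, Subgroup.card_top, hZcard, hScard] at h
    exact Nat.eq_of_mul_eq_mul_right hp1.pos (h.trans (by ring))
  have hc4 : ∀ g ∈ Q, g ∉ W → Nat.card (Subgroup.centralizer {g}) = p ^ 4 := by
    intro g hg hgW
    obtain ⟨k, hkQ, hk⟩ := hnoncomm g hg (fun h => hgW (hZW h))
    have h := card_centralizer_inf_mul_of_commutator_mem (K := Q) (N := Z) (hZcard ▸ hp1)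
      hZcenter (fun k hk => hcommQ k hk g hg) hkQ hk
    have hle : Subgroup.centralizer {g} ≤ Q := by
      intro t ht
      by_contra htQ
      refine hgW (hCQW t htQ ⟨?_, hg⟩)
      rw [Subgroup.mem_centralizer_singleton_iff] at ht
      exact Subgroup.mem_centralizer_singleton_iff.2 ht.symm
    rw [inf_eq_left.2 hle, hZcard, hQcard] at h
    exact Nat.eq_of_mul_eq_mul_right hp1.pos (h.trans (by ring))
  obtain ⟨w, hwW, hwZ⟩ : ∃ w ∈ W, w ∉ Z := by
    refine SetLike.not_le_iff_exists.1 fun h => ?_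
    have := Subgroup.card_le_of_le h
    rw [hZcard, hWcard] at this
    nlinarith [hp1.one_lt]
  set M : Subgroup S := Subgroup.centralizer {w} with hM
  have hMcard : Nat.card M = p ^ 5 := hc5 w hwW hwZ
  have hMQcard : Nat.card (M ⊓ Q : Subgroup S) = p ^ 4 := by
    have hnle : ¬ M ≤ Q := by
      intro h
      have hMQ : M = Q := Subgroup.eq_of_le_of_card_ge h (by rw [hMcard, hQcard])
      refine hwZ ((hZ_iff w).2 ⟨hWQ hwW, fun y hy => ?_⟩)
      exact Subgroup.mem_centralizer_singleton_iff.1 (hM ▸ hMQ ▸ hy)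
    have h := card_inf_mul_index_of_not_le (hQidx ▸ hp1) hnle
    rw [hQidx, hMcard] at h
    exact Nat.eq_of_mul_eq_mul_right hp1.pos (h.trans (by ring))
  have hcout : ∀ s ∉ Q, Nat.card (Subgroup.centralizer {s}) =
      Nat.card (Subgroup.centralizer {s} ⊓ Q : Subgroup S) * p := by
    intro s hs
    have h := card_inf_mul_index_of_not_le (H := Subgroup.centralizer {s}) (hQidx ▸ hp1)
      fun h => hs (h (Subgroup.mem_centralizer_singleton_iff.2 rfl))
    rw [hQidx] at h
    exact h.symm
  have hcases : ∀ H : Subgroup S, H ≤ W → Z ≤ H → H = Z ∨ H = W := by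
    intro H hHW hZH
    have hd := Subgroup.card_dvd_of_le hHW
    rw [hWcard, Nat.dvd_prime_pow hp1] at hd
    obtain ⟨i, hi, hH⟩ := hd
    obtain h | h : i ≤ 1 ∨ i = 2 := by omega
    · left
      refine (Subgroup.eq_of_le_of_card_ge hZH ?_).symm
      rw [hH, hZcard]
      exact (Nat.pow_le_pow_right hp1.pos h).trans_eq (pow_one p)
    · right
      exact Subgroup.eq_of_le_of_card_ge hHW (by rw [hH, hWcard, h])
  have hmemM : ∀ s, s ∈ M ↔ w ∈ Subgroup.centralizer {s} := fun s => by
    rw [hM, Subgroup.mem_centralizer_singleton_iff, Subgroup.mem_centralizer_singleton_iff,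
      eq_comm]
  have hc3 : ∀ s ∉ Q, s ∈ M → Nat.card (Subgroup.centralizer {s}) = p ^ 3 := by
    intro s hs hsM
    obtain h | h := hcases _ (hCQW s hs) (le_inf (hZC s) hZQ)
    · exact (hwZ (h ▸ ⟨(hmemM s).1 hsM, hWQ hwW⟩)).elim
    · rw [hcout s hs, h, hWcard]
      ring
  have hc2 : ∀ s ∉ Q, s ∉ M → Nat.card (Subgroup.centralizer {s}) = p ^ 2 := by
    intro s hs hsM
    obtain h | h := hcases _ (hCQW s hs) (le_inf (hZC s) hZQ)
    · rw [hcout s hs, h, hZcard]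
      ring
    · exact (hsM ((hmemM s).2 (h.ge hwW).1)).elim
  have hc6 : ∀ z ∈ Z, Nat.card (Subgroup.centralizer {z}) = p ^ 6 := by
    intro z hz
    have : Subgroup.centralizer {z} = ⊤ := top_unique fun x _ =>
      Subgroup.mem_centralizer_singleton_iff.2 (Subgroup.mem_center_iff.1 (hZcenter hz) x)
    rw [this, Subgroup.card_top, hScard]
  classical
  have := Fintype.ofFinite S
  have hcentralizer : ∀ g : S, (Nat.card (Subgroup.centralizer {g}) : ℤ) =
      p ^ 2 + (if g ∈ Q then (p ^ 4 - p ^ 2 : ℤ) else 0) +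
        (if g ∈ W then (p ^ 5 - p ^ 4 : ℤ) else 0) + (if g ∈ Z then (p ^ 6 - p ^ 5 : ℤ) else 0) +
        (if g ∈ M then (p ^ 3 - p ^ 2 : ℤ) else 0) -
        (if g ∈ M ⊓ Q then (p ^ 3 - p ^ 2 : ℤ) else 0) := by
    intro g
    rw [if_congr (Subgroup.mem_inf (p := M) (p' := Q)) rfl rfl]
    by_cases hgQ : g ∈ Q
    · by_cases hgW : g ∈ W
      · by_cases hgZ : g ∈ Z
        · rw [hc6 g hgZ]
          simp [hgQ, hgW, hgZ]
        · rw [hc5 g hgW hgZ]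
          simp [hgQ, hgW, hgZ]
      · have hgZ : g ∉ Z := fun h => hgW (hZW h)
        rw [hc4 g hgQ hgW]
        simp [hgQ, hgW, hgZ]
    · have hgW : g ∉ W := fun h => hgQ (hWQ h)
      have hgZ : g ∉ Z := fun h => hgQ (hZQ h)
      by_cases hgM : g ∈ M
      · rw [hc3 g hgQ hgM]
        simp [hgQ, hgW, hgZ, hgM]
      · rw [hc2 g hgQ hgM]
        simp [hgQ, hgW, hgZ, hgM]
  have hsum := sum_card_centralizer_eq S
  have hmul : (Nat.card (ConjClasses S) : ℤ) * p ^ 6 =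
      (p ^ 3 + 2 * p ^ 2 - p - 1) * p ^ 6 := by
    have h := congrArg (Nat.cast (R := ℤ)) hsum
    push_cast at h
    rw [Finset.sum_congr rfl fun g _ => hcentralizer g, hScard] at h
    simp only [Finset.sum_sub_distrib, Finset.sum_add_distrib, sum_ite_mem_subgroup,
      Finset.sum_const, Finset.card_univ, ← Nat.card_eq_fintype_card (α := S), hScard, hQcard,
      hWcard, hZcard, hMcard, hMQcard, nsmul_eq_mul] at h
    push_cast at h
    linear_combination -h
  have hk : (Nat.card (ConjClasses S) : ℤ) = p ^ 3 + 2 * p ^ 2 - p - 1 :=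
    mul_right_cancel₀ (pow_ne_zero 6 (Nat.cast_ne_zero.2 hp1.ne_zero)) hmul
  have hk' : Nat.card (ConjClasses S) + p + 1 = p ^ 3 + 2 * p ^ 2 := by
    zify
    linear_combination hk
  omega
end
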